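/- Let Π=(P,L) be a connected partial linear space satisfying conditions (a)–(e) of the Setting. Let C be a connected component of the graph (P,⊥) which has diameter 2, i.e., C contains two distinct points that are collinear in Π. Then C is a subspace of Π and the collinearity graph of Π induced on C is connected. -/

import Mathlib

universe u

/-- A *partial linear space*: a set of points `P` together with a set `L` of
subsets of `P` of size at least `2` (the *lines*), such that two distinct
points lie on at most one common line. -/
structure PLS (P : Type u) where
  L : Set (Set P)
  nontrivial_lines : ∀ l ∈ L, Set.Nontrivial l
  unique_line : ∀ l ∈ L, ∀ m ∈ L, ∀ x y : P, x ≠ y →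
    x ∈ l → y ∈ l → x ∈ m → y ∈ m → l = m

namespace PLS

variable {P : Type u} (S : PLS P)

/-- `x ∼ y` : the points are distinct and lie on a common line. -/
def Collinear (x y : P) : Prop := x ≠ y ∧ ∃ l ∈ S.L, x ∈ l ∧ y ∈ l

/-- `x ⊥ y` : `x = y` or `x` and `y` are non-collinear. -/
def Perp (x y : P) : Prop := ¬ S.Collinear x y

/-- `x^⊥` : the set of points `y` with `x ⊥ y`. -/
def perpSet (x : P) : Set P := {y | S.Perp x y}

/-- Adjacency in the graph `(P, ⊥)` : distinct points with `x ⊥ y`. -/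
def PerpAdj (x y : P) : Prop := x ≠ y ∧ S.Perp x y

/-- `X^⊥` for a set `X` of points: points `⊥` to every point of `X`. -/
def setPerp (X : Set P) : Set P := {z | ∀ p ∈ X, S.Perp z p}

/-- `(xy)^{⊥⊥} = {z ∈ P : z ⊥ u for every u ∈ x^⊥ ∩ y^⊥}`. -/
def doublePerp (x y : P) : Set P :=
  {z | ∀ u ∈ S.perpSet x ∩ S.perpSet y, S.Perp z u}

/-- A subspace: every line meeting it in at least two points is contained in it. -/
def IsSubspace (X : Set P) : Prop :=
  ∀ l ∈ S.L, (∃ x ∈ l ∩ X, ∃ y ∈ l ∩ X, x ≠ y) → l ⊆ X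

/-- `⟨Y⟩`, the subspace generated by `Y`. -/
def span (Y : Set P) : Set P := ⋂₀ {X | S.IsSubspace X ∧ Y ⊆ X}

/-- A plane: the subspace generated by two distinct lines meeting in a point. -/
def IsPlane (X : Set P) : Prop :=
  ∃ l ∈ S.L, ∃ m ∈ S.L, l ≠ m ∧ (l ∩ m).Nonempty ∧ X = S.span (l ∪ m)

/-- A transversal plane: a plane `X` such that for every line `ℓ ⊆ X` the sets
`x^⊥ ∩ X`, for `x ∈ ℓ`, partition `X` (every point of `X` lies in exactly one
of them). -/
def IsTransversalPlane (X : Set P) : Prop :=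
  S.IsPlane X ∧ ∀ l ∈ S.L, l ⊆ X → ∀ p ∈ X, ∃! x, x ∈ l ∧ S.Perp x p

/-- `T` is a transversal of `X`: `T = x^⊥ ∩ X` for a point `x` on a line of `X`. -/
def IsTransversalOf (T X : Set P) : Prop :=
  ∃ l ∈ S.L, l ⊆ X ∧ ∃ x ∈ l, T = S.perpSet x ∩ X

/-- Connectedness of the collinearity graph `(P, ∼)`. -/
def Connected : Prop := ∀ x y : P, Relation.ReflTransGen S.Collinear x y

/-- Connectedness of the graph `(P, ⊥)`. -/
def CoConnected : Prop := ∀ x y : P, Relation.ReflTransGen S.PerpAdj x y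

/-- The one-or-all axiom for polar spaces. -/
def IsPolar : Prop :=
  ∀ p : P, ∀ l ∈ S.L, p ∉ l →
    (∃! q, q ∈ l ∧ S.Collinear p q) ∨ (∀ q ∈ l, S.Collinear p q)

/-- Non-degeneracy: the radical is empty, i.e. no point is collinear with all
other points. -/
def Nondegenerate : Prop := ∀ p : P, ∃ q, q ≠ p ∧ ¬ S.Collinear p q

/-- In a polar space, `p^⊥` denotes the points equal or collinear to `p`. -/
def polarPerp (x : P) : Set P := {q | q = x ∨ S.Collinear x q}

/-- `X^⊥` in a polar space, for a set of points `X`. -/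
def polarPerpSet (X : Set P) : Set P := {q | ∀ x ∈ X, q ∈ S.polarPerp x}

/-- The hyperbolic line on two non-collinear points of a polar space:
`{z : z ∈ u^⊥ for every u ∈ x^⊥ ∩ y^⊥}`. -/
def polarHypLine (x y : P) : Set P :=
  {z | ∀ u ∈ S.polarPerp x ∩ S.polarPerp y, z ∈ S.polarPerp u}

/-- A linear set: any two of its distinct points are collinear. -/
def IsLinearSet (X : Set P) : Prop := ∀ x ∈ X, ∀ y ∈ X, x ≠ y → S.Collinear x y

/-- Planarity: any two distinct lines meeting in a point are contained in a
unique plane. -/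
def Planar : Prop :=
  ∀ l ∈ S.L, ∀ m ∈ S.L, l ≠ m → (l ∩ m).Nonempty →
    ∃! π, S.IsPlane π ∧ l ⊆ π ∧ m ⊆ π

/-- A projective plane: a linear space in which any two distinct lines meet in
a point, containing four points no three of which are collinear. -/
def IsProjectivePlane : Prop :=
  (∀ x y : P, x ≠ y → ∃ l ∈ S.L, x ∈ l ∧ y ∈ l) ∧
  (∀ l ∈ S.L, ∀ m ∈ S.L, l ≠ m → (l ∩ m).Nonempty) ∧
  (∃ a b c d : P, a ≠ b ∧ a ≠ c ∧ a ≠ d ∧ b ≠ c ∧ b ≠ d ∧ c ≠ d ∧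
    ∀ l ∈ S.L, ¬(a ∈ l ∧ b ∈ l ∧ c ∈ l) ∧ ¬(a ∈ l ∧ b ∈ l ∧ d ∈ l) ∧
      ¬(a ∈ l ∧ c ∈ l ∧ d ∈ l) ∧ ¬(b ∈ l ∧ c ∈ l ∧ d ∈ l))

/-- `π` is isomorphic to a dual affine plane: there is a projective plane `T`
on a point set `Q`, a point `p` of `T`, and a bijection from `π` onto `Q ∖ {p}`
under which the lines of `Π` contained in `π` correspond exactly to the lines
of `T` not passing through `p`. -/
def IsDualAffine (π : Set P) : Prop :=
  ∃ (Q : Type u) (T : PLS Q) (p : Q) (f : P → Q),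
    T.IsProjectivePlane ∧ Set.BijOn f π {q | q ≠ p} ∧
    ∀ s : Set P, s ⊆ π → (s ∈ S.L ↔ f '' s ∈ T.L ∧ p ∉ f '' s)

/-- A linear plane contains four distinct lines which pairwise meet and whose
pairwise intersection points are six distinct points. -/
def FourLinesSixPoints (π : Set P) : Prop :=
  ∃ l : Fin 4 → Set P, (∀ i, l i ∈ S.L ∧ l i ⊆ π) ∧ Function.Injective l ∧
    ∃ pt : Fin 4 → Fin 4 → P,
      (∀ i j, i < j → pt i j ∈ l i ∩ l j) ∧
      (∀ i j k m, i < j → k < m → (i, j) ≠ (k, m) → pt i j ≠ pt k m)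

/-- Conditions (a)–(d) of the Main Hypothesis, for a connected and co-connected
partial linear space:
(a) all lines have at least `4` points;
(b) `x^⊥ ⊆ y^⊥` implies `x = y`;
(c) every triple `x ∼ y ∼ z`, `x ⊥ z`, `x ≠ z`, generates a transversal plane;
(d) for every point `p` and transversal plane `π`, `p^⊥ ∩ π` is empty, a
point, a line, or a transversal of `π`. -/
def MainHyp : Prop :=
  S.Connected ∧ S.CoConnected ∧
  (∀ l ∈ S.L, 4 ≤ Cardinal.mk ↥l) ∧
  (∀ x y : P, S.perpSet x ⊆ S.perpSet y → x = y) ∧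
  (∀ x y z : P, S.Collinear x y → S.Collinear y z → S.PerpAdj x z →
    S.IsTransversalPlane (S.span {x, y, z})) ∧
  (∀ p : P, ∀ π : Set P, S.IsTransversalPlane π →
    S.perpSet p ∩ π = ∅ ∨ (∃ q, S.perpSet p ∩ π = {q}) ∨
    S.perpSet p ∩ π ∈ S.L ∨ S.IsTransversalOf (S.perpSet p ∩ π) π)

/-- Conditions (a)–(e) of the Setting, for a connected partial linear space:
(a) all lines have at least `4` points;
(b) `x^⊥ ⊆ y^⊥` implies `x^⊥ = y^⊥`;
(c) there exist two distinct non-collinear points;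
(d) every triple `x ∼ y ∼ z`, `x ⊥ z`, `x ≠ z`, is contained in a transversal
plane;
(e) for every point `p` and transversal plane `π`, `p^⊥ ∩ π` is empty, a
point, a line, a transversal of `π`, or `π` itself. -/
def Setting : Prop :=
  S.Connected ∧
  (∀ l ∈ S.L, 4 ≤ Cardinal.mk ↥l) ∧
  (∀ x y : P, S.perpSet x ⊆ S.perpSet y → S.perpSet x = S.perpSet y) ∧
  (∃ x y : P, x ≠ y ∧ ¬ S.Collinear x y) ∧
  (∀ x y z : P, S.Collinear x y → S.Collinear y z → S.PerpAdj x z →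
    ∃ π, S.IsTransversalPlane π ∧ x ∈ π ∧ y ∈ π ∧ z ∈ π) ∧
  (∀ p : P, ∀ π : Set P, S.IsTransversalPlane π →
    S.perpSet p ∩ π = ∅ ∨ (∃ q, S.perpSet p ∩ π = {q}) ∨
    S.perpSet p ∩ π ∈ S.L ∨ S.IsTransversalOf (S.perpSet p ∩ π) π ∨
    S.perpSet p ∩ π = π)

end PLS


namespace PLS

variable {P : Type u} (S : PLS P)

theorem Collinear.sym {S : PLS P} {x y : P} (h : S.Collinear x y) : S.Collinear y x := by
  obtain ⟨h1, l, hl, hx, hy⟩ := h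
  exact ⟨h1.symm, l, hl, hy, hx⟩

theorem Perp.sym {S : PLS P} {x y : P} (h : S.Perp x y) : S.Perp y x :=
  fun h' => h h'.sym

theorem perp_self (x : P) : S.Perp x x := fun h => h.1 rfl

theorem not_perp {S : PLS P} {x y : P} (h : ¬ S.Perp x y) : S.Collinear x y := by
  by_contra h'
  exact h h'

theorem eq_of_perp {S : PLS P} {l : Set P} (hl : l ∈ S.L) {x y : P} (hx : x ∈ l) (hy : y ∈ l)
    (h : S.Perp x y) : x = y := by
  by_contra hne
  exact h ⟨hne, l, hl, hx, hy⟩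

theorem tp_line {S : PLS P} {π : Set P} (h : S.IsTransversalPlane π) {u v : P} (hu : u ∈ π)
    (hv : v ∈ π) (hne : u ≠ v) {l : Set P} (hl : l ∈ S.L) (hul : u ∈ l) (hvl : v ∈ l) :
    l ⊆ π := by
  obtain ⟨⟨m, _, n, _, _, _, rfl⟩, _⟩ := h
  intro w hw X hX
  exact hX.1 l hl ⟨u, ⟨hul, hu X hX⟩, v, ⟨hvl, hv X hX⟩, hne⟩ hw

theorem tp_meet {S : PLS P} {π : Set P} (h : S.IsTransversalPlane π) {l : Set P}
    (hl : l ∈ S.L) (hlπ : l ⊆ π) {p : P} (hp : p ∈ π) : ∃ x ∈ l, S.Perp x p := by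
  obtain ⟨x, hx, _⟩ := h.2 l hl hlπ p hp
  exact ⟨x, hx.1, hx.2⟩

theorem tp_uniq {S : PLS P} {π : Set P} (h : S.IsTransversalPlane π) {l : Set P}
    (hl : l ∈ S.L) (hlπ : l ⊆ π) {p : P} (hp : p ∈ π) {x y : P} (hx : x ∈ l) (hy : y ∈ l)
    (hxp : S.Perp x p) (hyp : S.Perp y p) : x = y :=
  (h.2 l hl hlπ p hp).unique ⟨hx, hxp⟩ ⟨hy, hyp⟩

theorem tp_trans {S : PLS P} {π : Set P} (h : S.IsTransversalPlane π) {p q r : P}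
    (hp : p ∈ π) (hq : q ∈ π) (hr : r ∈ π) (hpq : S.Perp p q) (hqr : S.Perp q r) :
    S.Perp p r := by
  rintro ⟨hne, l, hl, hpl, hrl⟩
  exact hne (tp_uniq h hl (tp_line h hp hr hne hl hpl hrl) hq hpl hrl hpq hqr.sym)

theorem fourth {S : PLS P} (h : S.Setting) {l : Set P} (hl : l ∈ S.L) (x y z : P) :
    ∃ w ∈ l, w ≠ x ∧ w ≠ y ∧ w ≠ z := by
  by_contra hcon
  classical
  push Not at hcon
  have h4 := h.2.1 l hl
  have hsub : l ⊆ (({x, y, z} : Finset P) : Set P) := by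
    intro w hw
    by_cases h1 : w = x
    · simp [h1]
    by_cases h2 : w = y
    · simp [h2]
    simp [hcon w hw h1 h2]
  have h5 := h4.trans (Cardinal.mk_le_mk_of_subset hsub)
  have h7 : Cardinal.mk ↥(({x, y, z} : Finset P) : Set P) = (({x, y, z} : Finset P).card : Cardinal) :=
    Cardinal.mk_coe_finset
  rw [h7] at h5
  have h6 : 4 ≤ ({x, y, z} : Finset P).card := by exact_mod_cast h5
  have := Finset.card_le_three (a := x) (b := y) (c := z)
  omega

theorem one_or_all {S : PLS P} (h : S.Setting) {l : Set P} (hl : l ∈ S.L) {p x y z : P}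
    (hx : x ∈ l) (hy : y ∈ l) (hz : z ∈ l) (hne : x ≠ y) (hpx : S.Perp p x)
    (hpy : S.Perp p y) : S.Perp p z := by
  intro hpz
  have hxz : x ≠ z := by rintro rfl; exact hpx hpz
  by_cases hxp : p = x
  · subst hxp
    exact hne (eq_of_perp hl hx hy hpy)
  obtain ⟨π, hπ, h1, h2, h3⟩ := h.2.2.2.2.1 p z x hpz ⟨hxz.symm, l, hl, hz, hx⟩ ⟨hxp, hpx⟩
  exact hne (tp_uniq hπ hl (tp_line hπ h3 h2 hxz hl hx hz) h1 hx hy hpx.sym hpy.sym)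

/-- Paths of length three in `(P, ⊥)` shorten. -/
theorem shorten {S : PLS P} (h : S.Setting) {a c d b : P} (hac : S.Perp a c)
    (hcd : S.Perp c d) (hdb : S.Perp d b) : ∃ v, S.Perp a v ∧ S.Perp v b := by
  by_cases hab : S.Perp a b
  · exact ⟨b, hab, S.perp_self b⟩
  by_cases had : S.Perp a d
  · exact ⟨d, had, hdb⟩
  by_cases hcb : S.Perp c b
  · exact ⟨c, hac, hcb⟩
  have hab' := not_perp hab
  have had' := not_perp had
  have hcb' := not_perp hcb
  have nac : a ≠ c := by rintro rfl; exact had hcd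
  have ndb : d ≠ b := by rintro rfl; exact hcb hcd
  have h5 := h.2.2.2.2.1
  obtain ⟨π, hπ, aπ, bπ, cπ⟩ := h5 a b c hab' hcb'.sym ⟨nac, hac⟩
  obtain ⟨π', hπ', dπ', aπ', bπ'⟩ := h5 d a b had'.sym hab' ⟨ndb, hdb⟩
  obtain ⟨nab, ab, hABl, aab, bab⟩ := hab'
  obtain ⟨nad, ad, hADl, aad, dad⟩ := had'
  obtain ⟨ncb, cb, hCBl, ccb, bcb⟩ := hcb'
  obtain ⟨x, xcb, nxc, nxb, _⟩ := fourth h hCBl c b b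
  have xπ : x ∈ π := tp_line hπ cπ bπ ncb hCBl ccb bcb xcb
  have hdx : S.Perp d x := one_or_all h hCBl ccb bcb xcb ncb hcd.sym hdb
  have hax : ¬ S.Perp a x := fun hax =>
    hab (one_or_all h hCBl ccb xcb bcb nxc.symm hac hax)
  obtain ⟨e, eab, hex⟩ := tp_meet hπ hABl (tp_line hπ aπ bπ nab hABl aab bab) xπ
  have nea : e ≠ a := by rintro rfl; exact hax hex
  have neb : e ≠ b := by
    rintro rfl; exact nxb (eq_of_perp hCBl bcb xcb hex).symm
  have eπ' : e ∈ π' := tp_line hπ' aπ' bπ' nab hABl aab bab eab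
  obtain ⟨y, yad, hye⟩ := tp_meet hπ' hADl (tp_line hπ' aπ' dπ' nad hADl aad dad) eπ'
  have nyd : y ≠ d := by
    rintro rfl
    exact had (one_or_all h hABl eab bab aab neb hye hdb).sym
  have hxy : ¬ S.Perp x y := fun hxy =>
    hax (one_or_all h hADl yad dad aad nyd hxy hdx.sym).sym
  have nxd : x ≠ d := by
    rintro rfl
    exact ndb (eq_of_perp hCBl xcb bcb hdb)
  obtain ⟨π2, hπ2, xπ2, aπ2, dπ2⟩ := h5 x a d (not_perp hax).sym ⟨nad, ad, hADl, aad, dad⟩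
    ⟨nxd, hdx.sym⟩
  have yπ2 : y ∈ π2 := tp_line hπ2 aπ2 dπ2 nad hADl aad dad yad
  obtain ⟨nxy, xy, hXYl, xxy, yxy⟩ := not_perp hxy
  obtain ⟨v, vxy, hva⟩ := tp_meet hπ2 hXYl (tp_line hπ2 xπ2 yπ2 nxy hXYl xxy yxy) aπ2
  have hev : S.Perp e v := one_or_all h hXYl xxy yxy vxy nxy hex hye.sym
  exact ⟨v, hva.sym, one_or_all h hABl aab eab bab nea.symm hva hev.sym⟩

theorem diam_two {S : PLS P} (h : S.Setting) {a b : P}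
    (hab : Relation.ReflTransGen S.PerpAdj a b) : ∃ v, S.Perp a v ∧ S.Perp v b := by
  induction hab with
  | refl => exact ⟨a, S.perp_self a, S.perp_self a⟩
  | tail _ h2 ih =>
    obtain ⟨v, h3, h4⟩ := ih
    exact shorten h h3 h4 h2.2

theorem rtg_of_perp {S : PLS P} {x a b : P} (h : Relation.ReflTransGen S.PerpAdj x a)
    (hab : S.Perp a b) : Relation.ReflTransGen S.PerpAdj x b := by
  by_cases hne : a = b
  · exact hne ▸ h
  · exact h.tail ⟨hne, hab⟩

theorem rtg_sym {S : PLS P} {a b : P} (h : Relation.ReflTransGen S.PerpAdj a b) :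
    Relation.ReflTransGen S.PerpAdj b a := by
  induction h with
  | refl => exact .refl
  | tail _ h2 ih => exact .head ⟨h2.1.symm, h2.2.sym⟩ ih

/-- A transversal contains a point different from two given ones. -/
theorem third {S : PLS P} (h : S.Setting) {π : Set P} (hπ : S.IsTransversalPlane π)
    {a b p : P} (aπ : a ∈ π) (bπ : b ∈ π) (pπ : p ∈ π) (nab : a ≠ b) (hab : S.Perp a b)
    (hap : S.Collinear a p) (hbp : S.Collinear b p) :
    ∃ z ∈ π, z ≠ a ∧ z ≠ b ∧ S.Perp z a := by
  obtain ⟨nap, l, hl, al, pl⟩ := hap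
  obtain ⟨nbp, m, hm, bm, pm⟩ := hbp
  have hlm : l ≠ m := by
    rintro rfl
    exact nab (eq_of_perp hl al bm hab)
  have lπ := tp_line hπ aπ pπ nap hl al pl
  have mπ := tp_line hπ bπ pπ nbp hm bm pm
  obtain ⟨w, wm, nwb, nwp, _⟩ := fourth h hm b p p
  obtain ⟨w', wl', hw'⟩ := tp_meet hπ hl lπ (mπ wm)
  obtain ⟨u, ul, nua, nup, nuw⟩ := fourth h hl a p w'
  have huw : ¬ S.Perp u w := fun huw => nuw (tp_uniq hπ hl lπ (mπ wm) ul wl' huw hw')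
  obtain ⟨nuw, n, hn, un, wn⟩ := not_perp huw
  have nπ := tp_line hπ (lπ ul) (mπ wm) nuw hn un wn
  obtain ⟨z, zn, hza⟩ := tp_meet hπ hn nπ aπ
  refine ⟨z, nπ zn, ?_, ?_, hza⟩
  · rintro rfl
    have : n = l := S.unique_line n hn l hl z u nua.symm zn un al ul
    subst this
    exact hlm (S.unique_line n hn m hm w p nwp wn pl wm pm)
  · rintro rfl
    have : n = m := S.unique_line n hn m hm z w nwb.symm zn wn bm wm
    subst this
    exact hlm (S.unique_line l hl n hn u p nup ul pl un pm)

end PLS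

open PLS in
/-- 3.9. In the Setting, a connected component of `(P, ⊥)`
of diameter `2` (i.e. containing two distinct collinear points) is a subspace
of `Π` whose induced collinearity graph is connected. -/
theorem component_subspace {P : Type u} (S : PLS P) (h : S.Setting)
    (x₀ : P) (C : Set P)
    (hC : C = {y | Relation.ReflTransGen S.PerpAdj x₀ y})
    (hdiam : ∃ a ∈ C, ∃ b ∈ C, S.Collinear a b) :
    S.IsSubspace C ∧
      ∀ a ∈ C, ∀ b ∈ C,
        Relation.ReflTransGen
          (fun u v => u ∈ C ∧ v ∈ C ∧ S.Collinear u v) a b := by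
  have hclos : ∀ a ∈ C, ∀ b, S.Perp a b → b ∈ C := by
    subst hC
    intro a ha b hab
    exact rtg_of_perp ha hab
  have hconn : ∀ a ∈ C, ∀ b ∈ C, Relation.ReflTransGen S.PerpAdj a b := by
    subst hC
    intro a ha b hb
    exact (rtg_sym ha).trans hb
  have hsub : S.IsSubspace C := by
    rintro l hl ⟨a, ⟨al, aC⟩, b, ⟨bl, bC⟩, hne⟩ z hz
    obtain ⟨v, hav, hvb⟩ := diam_two h (hconn a aC b bC)
    exact hclos v (hclos a aC v hav) z (one_or_all h hl al bl hz hne hav.sym hvb)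
  refine ⟨hsub, ?_⟩
  have hnb : ∀ a ∈ C, ∃ a' ∈ C, S.Collinear a a' := by
    intro a aC
    by_contra hcon
    push Not at hcon
    obtain ⟨u, uC, v, vC, huv⟩ := hdiam
    have h1 : S.perpSet u ⊆ S.perpSet a := fun w hw => hcon w (hclos u uC w hw)
    have h2 := h.2.2.1 u a h1
    have h3 : v ∈ S.perpSet u := by
      rw [h2]
      exact hcon v vC
    exact h3 huv
  by_cases hall : ∀ p, p ∈ C
  · intro a _ b _
    have hab := h.1 a b
    induction hab with
    | refl => exact .refl
    | tail _ h2 ih => exact (ih (hall _)).tail ⟨hall _, hall _, h2⟩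
  push Not at hall
  obtain ⟨p, hp⟩ := hall
  have hpc : ∀ a ∈ C, S.Collinear a p := fun a aC => by
    by_contra hcon
    exact hp (hclos a aC p hcon)
  have key : ∀ a ∈ C, ∀ b ∈ C, S.PerpAdj a b → Relation.ReflTransGen
          (fun u v => u ∈ C ∧ v ∈ C ∧ S.Collinear u v) a b := by
    intro a aC b bC ⟨nab, hab⟩
    obtain ⟨a', aC', haa'⟩ := hnb a aC
    obtain ⟨b', bC', hbb'⟩ := hnb b bC
    obtain ⟨π, hπ, aπ, pπ, bπ⟩ := h.2.2.2.2.1 a p b (hpc a aC) (hpc b bC).sym ⟨nab, hab⟩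
    obtain ⟨z, zπ, nza, nzb, hza⟩ := third h hπ aπ bπ pπ nab hab (hpc a aC) (hpc b bC)
    have hzb : S.Perp z b := tp_trans hπ zπ aπ bπ hza hab
    have zC : z ∈ C := hclos a aC z hza.sym
    -- points of the plane in `C` are in the class of `a`
    have hcls : ∀ w ∈ π, w ∈ C → S.Perp w a := by
      intro w wπ wC
      obtain ⟨nap, l, hl, al, pl⟩ := hpc a aC
      obtain ⟨q, ql, hqw⟩ := tp_meet hπ hl (tp_line hπ aπ pπ nap hl al pl) wπ
      have qC := hclos w wC q hqw.sym
      by_cases hqa : q = a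
      · exact hqa ▸ hqw.sym
      · exact absurd (hsub l hl ⟨q, ⟨ql, qC⟩, a, ⟨al, aC⟩, hqa⟩ pl) hp
    have main : ∀ r ∈ C, ∀ s ∈ π, S.Perp s a → ∀ t ∈ π, S.Perp t a → ∀ z ∈ π, S.Perp z a →
        S.Collinear r s → z ≠ t → S.Perp r t → S.Collinear r z := by
      intro r rC s sπ hsa t tπ hta z zπ hza hrs nzt hrt
      by_contra hrz
      have hin : ∀ w ∈ S.perpSet r ∩ π, S.Perp w a := fun w hw =>
        hcls w hw.2 (hclos r rC w hw.1)
      have tin : t ∈ S.perpSet r ∩ π := ⟨hrt, tπ⟩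
      have zin : z ∈ S.perpSet r ∩ π := ⟨hrz, zπ⟩
      rcases h.2.2.2.2.2 r π hπ with h1 | ⟨q, h1⟩ | h1 | ⟨l, hl, hlπ, x, hx, h1⟩ | h1
      · rw [h1] at tin; exact tin
      · rw [h1] at tin zin
        exact nzt (zin.trans tin.symm)
      · exact nzt (eq_of_perp h1 zin tin (tp_trans hπ zπ aπ tπ hza hta.sym))
      · have hxz : S.Perp x z := by rw [h1] at zin; exact zin.1
        have hs : s ∈ S.perpSet r ∩ π := by
          rw [h1]
          exact ⟨tp_trans hπ (hlπ hx) zπ sπ hxz (tp_trans hπ zπ aπ sπ hza hsa.sym), sπ⟩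
        exact hs.1 hrs
      · have hs : s ∈ S.perpSet r ∩ π := by rw [h1]; exact sπ
        exact hs.1 hrs
    by_cases c1 : S.Perp a' b
    swap
    · exact .head ⟨aC, aC', haa'⟩ (.single ⟨aC', bC, not_perp c1⟩)
    by_cases c2 : S.Perp b' a
    swap
    · exact .head ⟨aC, bC', (not_perp c2).sym⟩ (.single ⟨bC', bC, hbb'.sym⟩)
    have d1 : S.Collinear a' z := main a' aC' a aπ (S.perp_self a) b bπ hab.sym z zπ hza
      haa'.sym nzb c1
    have d2 : S.Collinear b' z := main b' bC' b bπ hab.sym a aπ (S.perp_self a) z zπ hza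
      hbb'.sym nza c2
    exact .head ⟨aC, aC', haa'⟩ (.head ⟨aC', zC, d1⟩
      (.head ⟨zC, bC', d2.sym⟩ (.single ⟨bC', bC, hbb'.sym⟩)))
  intro a aC b bC
  have hab := hconn a aC b bC
  clear bC
  have : b ∈ C ∧ Relation.ReflTransGen
          (fun u v => u ∈ C ∧ v ∈ C ∧ S.Collinear u v) a b := by
    induction hab with
    | refl => exact ⟨aC, .refl⟩
    | tail _ h2 ih =>
      have h3 := hclos _ ih.1 _ h2.2
      exact ⟨h3, ih.2.trans (key _ ih.1 _ h3 h2)⟩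
  exact this.2
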